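/- arXiv:1705.01890 — 3 statements merged into one kernel-verified Lean document; each statement's English description precedes it below -/
import Mathlib

section
/- Let 0 < δ ≤ 1. There is a constant C(δ) (one may take C(δ) = (1+δ)·(3/2)^{δ}) such that for all k, h ∈ ℤ² with h ≠ 0 and ‖h‖ ≥ 2‖k‖, one has | ‖k−h‖^{1+δ} − ‖h‖^{1+δ} | ≤ C(δ)·‖k‖·‖h‖^{δ}. -/
/-- The Euclidean norm of a lattice point `k ∈ ℤ²`. -/
noncomputable def znorm (k : ℤ × ℤ) : ℝ := Real.sqrt ((k.1 : ℝ) ^ 2 + (k.2 : ℝ) ^ 2)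

theorem znorm_eq_norm (k : ℤ × ℤ) : znorm k = ‖(⟨k.1, k.2⟩ : ℂ)‖ := by
  simp [znorm, Complex.norm_eq_sqrt_sq_add_sq]

theorem znorm_nonneg (k : ℤ × ℤ) : 0 ≤ znorm k := Real.sqrt_nonneg _

theorem abs_znorm_sub_sub_znorm_le (k h : ℤ × ℤ) : |znorm (k - h) - znorm h| ≤ znorm k := by
  have key := abs_norm_sub_norm_le (⟨h.1 - k.1, h.2 - k.2⟩ : ℂ) ⟨h.1, h.2⟩
  have hsub : znorm (k - h) = ‖(⟨h.1 - k.1, h.2 - k.2⟩ : ℂ)‖ := by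
    rw [znorm_eq_norm, ← norm_neg]
    congr 1
    apply Complex.ext <;> simp
  have hk : znorm k = ‖(⟨h.1 - k.1, h.2 - k.2⟩ - ⟨h.1, h.2⟩ : ℂ)‖ := by
    rw [znorm_eq_norm, ← norm_neg]
    congr 1
    apply Complex.ext <;> simp
  rwa [hsub, hk, znorm_eq_norm h]

/-- Bernoulli's inequality in homogeneous form. -/
theorem rpow_one_add_sub_rpow_one_add_le {δ x y : ℝ} (hδ : 0 ≤ δ) (hx : 0 < x) (hy : 0 ≤ y) :
    x ^ (1 + δ) - y ^ (1 + δ) ≤ (1 + δ) * (x - y) * x ^ δ := by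
  have hs : -1 ≤ y / x - 1 := by linarith [div_nonneg hy hx.le]
  have bern := one_add_mul_self_le_rpow_one_add hs (show 1 ≤ 1 + δ by linarith)
  rw [add_sub_cancel, Real.div_rpow hy hx.le, le_div_iff₀ (Real.rpow_pos_of_pos hx _),
    Real.rpow_one_add' hx.le (by positivity)] at bern
  rw [Real.rpow_one_add' hx.le (by positivity)]
  have hcancel : (1 + (1 + δ) * (y / x - 1)) * (x * x ^ δ)
      = x * x ^ δ - (1 + δ) * (x - y) * x ^ δ := by
    field_simp
    ring
  linarith

theorem abs_rpow_one_add_sub_rpow_one_add_le {δ x y M : ℝ} (hδ : 0 ≤ δ) (hx : 0 ≤ x)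
    (hy : 0 ≤ y) (hxM : x ≤ M) (hyM : y ≤ M) :
    |x ^ (1 + δ) - y ^ (1 + δ)| ≤ (1 + δ) * |x - y| * M ^ δ := by
  wlog hyx : y ≤ x generalizing x y
  · rw [abs_sub_comm, abs_sub_comm x]
    exact this hy hx hyM hxM (le_of_not_ge hyx)
  rcases hx.eq_or_lt with rfl | hx
  · obtain rfl := le_antisymm hyx hy
    simp
  have hmono : y ^ (1 + δ) ≤ x ^ (1 + δ) := by gcongr
  rw [abs_of_nonneg (sub_nonneg.2 hmono), abs_of_nonneg (sub_nonneg.2 hyx)]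
  refine (rpow_one_add_sub_rpow_one_add_le hδ hx hy).trans ?_
  have := sub_nonneg.2 hyx
  gcongr

/-- Analogue of Lemma 4.2 used in Appendix A: for `0 < δ ≤ 1` there is a constant `C(δ)`
such that for all `k, h ∈ ℤ²` with `h ≠ 0` and `‖h‖ ≥ 2‖k‖`,
`| ‖k−h‖^{1+δ} − ‖h‖^{1+δ} | ≤ C(δ)·‖k‖·‖h‖^{δ}`. -/
theorem delta_difference_appendix (δ : ℝ) (hδ : 0 < δ) (hδ1 : δ ≤ 1) :
    ∃ C : ℝ, 0 < C ∧ ∀ k h : ℤ × ℤ, h ≠ 0 → 2 * znorm k ≤ znorm h →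
      |znorm (k - h) ^ (1 + δ) - znorm h ^ (1 + δ)| ≤ C * znorm k * znorm h ^ δ := by
  refine ⟨(1 + δ) * (3 / 2) ^ δ, by positivity, fun k h _ hkh => ?_⟩
  have hdiff := abs_znorm_sub_sub_znorm_le k h
  have hh := znorm_nonneg h
  calc |znorm (k - h) ^ (1 + δ) - znorm h ^ (1 + δ)|
      ≤ (1 + δ) * |znorm (k - h) - znorm h| * (3 / 2 * znorm h) ^ δ :=
        abs_rpow_one_add_sub_rpow_one_add_le hδ.le (znorm_nonneg _) hh
          (by linarith [le_abs_self (znorm (k - h) - znorm h)]) (by linarith)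
    _ ≤ (1 + δ) * znorm k * (3 / 2 * znorm h) ^ δ := by gcongr
    _ = (1 + δ) * (3 / 2) ^ δ * znorm k * znorm h ^ δ := by
        rw [Real.mul_rpow (by norm_num) hh]
        ring
end

section
/- Let 0 < δ ≤ 1. There is a constant C(δ) such that for every k ∈ ℤ² with k ≠ 0, Σ_{h ∈ ℤ², h ≠ 0, h ≠ k} (‖h‖^{−δ} − ‖k−h‖^{−δ})²·(‖h‖ − ‖k−h‖)² / ‖k−h‖² ≤ C(δ)·(‖k‖² + ‖k‖^{2−2δ}). -/
theorem one_le_znorm {k : ℤ × ℤ} (hk : k ≠ 0) : 1 ≤ znorm k := by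
  have h : (0 : ℤ) < k.1 ^ 2 + k.2 ^ 2 := by
    by_contra! h
    refine hk (Prod.ext ?_ ?_)
    · exact pow_eq_zero_iff two_ne_zero |>.1 (by nlinarith [sq_nonneg k.1, sq_nonneg k.2])
    · exact pow_eq_zero_iff two_ne_zero |>.1 (by nlinarith [sq_nonneg k.1, sq_nonneg k.2])
  rw [znorm, Real.one_le_sqrt]
  exact_mod_cast h

/-- The reverse triangle inequality for `znorm`. -/
theorem abs_znorm_sub_znorm_sub_le (k h : ℤ × ℤ) : |znorm h - znorm (k - h)| ≤ znorm k := by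
  simp only [znorm_eq_norm]
  have hsum : (⟨k.1, k.2⟩ : ℂ) = ⟨h.1, h.2⟩ - -⟨(k - h).1, (k - h).2⟩ := by
    apply Complex.ext <;> simp
  rw [hsum, ← norm_neg (⟨(k - h).1, (k - h).2⟩ : ℂ)]
  exact abs_norm_sub_norm_le _ _

theorem norm_le_znorm (x : Fin 2 → ℤ) : ‖x‖ ≤ znorm (x 0, x 1) := by
  refine (pi_norm_le_iff_of_nonneg (znorm_nonneg _)).2 fun i => ?_
  rw [Int.norm_eq_abs]
  fin_cases i
  · exact Real.abs_le_sqrt (le_add_of_nonneg_right (sq_nonneg _))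
  · exact Real.abs_le_sqrt (le_add_of_nonneg_left (sq_nonneg _))

theorem summable_znorm_rpow_neg {r : ℝ} (hr : 2 < r) :
    Summable fun h : ℤ × ℤ => znorm h ^ (-r) := by
  rw [← (finTwoArrowEquiv ℤ).summable_iff]
  refine (EisensteinSeries.summable_one_div_norm_rpow hr).of_nonneg_of_le
    (fun x => Real.rpow_nonneg (znorm_nonneg _) _) fun x => ?_
  by_cases hx : x = 0
  · subst hx
    simp [znorm]
  · exact Real.rpow_le_rpow_of_nonpos (norm_pos_iff.2 hx) (norm_le_znorm x) (by linarith)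

/-- The square of a difference of negative powers, divided by the square of one of the bases. -/
theorem rpow_neg_sub_rpow_neg_sq_div_le {a b δ : ℝ} (ha : 0 < a) (hb : 0 < b) (hδ : 0 < δ) :
    (a ^ (-δ) - b ^ (-δ)) ^ 2 / b ^ 2 ≤ a ^ (-(2 + 2 * δ)) + b ^ (-(2 + 2 * δ)) := by
  have key : ∀ x : ℝ, 0 < x → x ^ (-(2 + 2 * δ)) = (x ^ (-δ)) ^ 2 / x ^ 2 := fun x hx => by
    rw [← Real.rpow_mul_natCast hx.le, ← Real.rpow_natCast x 2, ← Real.rpow_sub hx]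
    congr 1
    push_cast
    ring
  have ha' := Real.rpow_pos_of_pos ha (-δ)
  have hb' := Real.rpow_pos_of_pos hb (-δ)
  rw [key a ha, key b hb]
  rcases le_total a b with h | h
  · have hab := Real.rpow_le_rpow_of_nonpos ha h (neg_nonpos.2 hδ.le)
    calc (a ^ (-δ) - b ^ (-δ)) ^ 2 / b ^ 2 ≤ (a ^ (-δ)) ^ 2 / a ^ 2 := by
          gcongr
          linarith
      _ ≤ _ := le_add_of_nonneg_right (by positivity)
  · have hab := Real.rpow_le_rpow_of_nonpos hb h (neg_nonpos.2 hδ.le)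
    calc (a ^ (-δ) - b ^ (-δ)) ^ 2 / b ^ 2 ≤ (b ^ (-δ)) ^ 2 / b ^ 2 := by
          gcongr ?_ / _
          nlinarith
      _ ≤ _ := le_add_of_nonneg_left (by positivity)

/-- The estimate of the sum `S₂` in the proof of Proposition 4.1: for `0 < δ ≤ 1` there is a
constant `C(δ)` such that for every `k ≠ 0`,
`Σ_{h≠0, h≠k} (‖h‖^{−δ} − ‖k−h‖^{−δ})²·(‖h‖ − ‖k−h‖)² / ‖k−h‖² ≤ C(δ)·(‖k‖² + ‖k‖^{2−2δ})`
(the sum being finite). -/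
theorem S2_estimate (δ : ℝ) (hδ : 0 < δ) (hδ1 : δ ≤ 1) :
    ∃ C : ℝ, 0 < C ∧ ∀ k : ℤ × ℤ, k ≠ 0 →
      Summable (fun h : {h : ℤ × ℤ // h ≠ 0 ∧ h ≠ k} =>
        (znorm (h : ℤ × ℤ) ^ (-δ) - znorm (k - (h : ℤ × ℤ)) ^ (-δ)) ^ 2
          * (znorm (h : ℤ × ℤ) - znorm (k - (h : ℤ × ℤ))) ^ 2
          / znorm (k - (h : ℤ × ℤ)) ^ 2) ∧
      (∑' h : {h : ℤ × ℤ // h ≠ 0 ∧ h ≠ k},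
        (znorm (h : ℤ × ℤ) ^ (-δ) - znorm (k - (h : ℤ × ℤ)) ^ (-δ)) ^ 2
          * (znorm (h : ℤ × ℤ) - znorm (k - (h : ℤ × ℤ))) ^ 2
          / znorm (k - (h : ℤ × ℤ)) ^ 2)
        ≤ C * (znorm k ^ 2 + znorm k ^ (2 - 2 * δ)) := by
  have hs := summable_znorm_rpow_neg (r := 2 + 2 * δ) (by linarith)
  set S := ∑' h : ℤ × ℤ, znorm h ^ (-(2 + 2 * δ)) with hS
  have hS0 : 0 ≤ S := tsum_nonneg fun h => Real.rpow_nonneg (znorm_nonneg h) _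
  refine ⟨2 * S + 1, by positivity, fun k hk => ?_⟩
  have hs' : Summable fun h : ℤ × ℤ => znorm (k - h) ^ (-(2 + 2 * δ)) :=
    (Equiv.subLeft k).summable_iff.2 hs
  have hS' : ∑' h : ℤ × ℤ, znorm (k - h) ^ (-(2 + 2 * δ)) = S :=
    (Equiv.subLeft k).tsum_eq fun h => znorm h ^ (-(2 + 2 * δ))
  set G : ℤ × ℤ → ℝ := fun h =>
    znorm k ^ 2 * (znorm h ^ (-(2 + 2 * δ)) + znorm (k - h) ^ (-(2 + 2 * δ))) with hG
  have hGs : Summable G := (hs.add hs').mul_left _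
  have hG0 : ∀ h, 0 ≤ G h := fun h =>
    mul_nonneg (sq_nonneg _) (add_nonneg (Real.rpow_nonneg (znorm_nonneg _) _)
      (Real.rpow_nonneg (znorm_nonneg _) _))
  have hGt : ∑' h, G h = znorm k ^ 2 * (2 * S) := by
    rw [hG, tsum_mul_left, hs.tsum_add hs', hS', ← hS, two_mul]
  have hle : ∀ h : {h : ℤ × ℤ // h ≠ 0 ∧ h ≠ k},
      (znorm (h : ℤ × ℤ) ^ (-δ) - znorm (k - (h : ℤ × ℤ)) ^ (-δ)) ^ 2
        * (znorm (h : ℤ × ℤ) - znorm (k - (h : ℤ × ℤ))) ^ 2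
        / znorm (k - (h : ℤ × ℤ)) ^ 2 ≤ G h := by
    rintro ⟨h, h0, h1⟩
    have ha := one_le_znorm h0
    have hb := one_le_znorm (sub_ne_zero.2 h1.symm)
    rw [mul_comm, mul_div_assoc]
    exact mul_le_mul (sq_le_sq.2 ((abs_znorm_sub_znorm_sub_le k h).trans (le_abs_self _)))
      (rpow_neg_sub_rpow_neg_sq_div_le (by linarith) (by linarith) hδ) (by positivity)
      (by positivity)
  have hGsub := hGs.subtype {h : ℤ × ℤ | h ≠ 0 ∧ h ≠ k}
  have hsum := hGsub.of_nonneg_of_le (fun h => by positivity) hle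
  refine ⟨hsum, (hsum.tsum_le_tsum hle hGsub).trans ?_⟩
  refine (hGs.tsum_subtype_le G {h : ℤ × ℤ | h ≠ 0 ∧ h ≠ k} hG0).trans ?_
  rw [hGt]
  have := Real.rpow_nonneg (znorm_nonneg k) (2 - 2 * δ)
  nlinarith [sq_nonneg (znorm k), mul_nonneg hS0 this]
end

section
/- Let 0 < δ ≤ 1 and let v : ℤ² → ℂ be finitely supported with v(0) = 0 and v(−k) = conj(v(k)) for all k ∈ ℤ². Then Re ( Σ_{k ∈ ℤ², k ≠ 0} ‖k‖² · conj(v(k)) · Σ_{h ∈ ℤ², h ≠ 0, h ≠ k} α_{k,h}·v(h)·v(k−h) ) = 0. In particular, the H¹ norm Σ_k ‖k‖²|v(k)|² is conserved along the (truncated) modified SQG flows dv_k/dt = Σ_h α_{k,h} v_h v_{k−h}. -/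
/-- `h^⊥ · k` where `h^⊥ = (−h₂, h₁)` and `·` is the standard dot product. -/
def perpDot (h k : ℤ × ℤ) : ℝ := ((-h.2 * k.1 + h.1 * k.2 : ℤ) : ℝ)

/-- The interaction coefficient
`α_{k,h} = (1/2)·((h^⊥·k)/‖k‖)·(‖k−h‖^{−δ}‖h‖ − ‖h‖^{−δ}‖k−h‖)`
of the modified SQG nonlinearity. -/
noncomputable def alphaCoef (δ : ℝ) (k h : ℤ × ℤ) : ℝ :=
  (1 / 2) * (perpDot h k / znorm k) *
    (znorm (k - h) ^ (-δ) * znorm h - znorm h ^ (-δ) * znorm (k - h))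

theorem znorm_neg (k : ℤ × ℤ) : znorm (-k) = znorm k := by
  simp [znorm]

/-- The rotation `(a, b) ↦ (b, c)` of the triads `a + b + c = 0`. -/
def triadRotation : (ℤ × ℤ) × (ℤ × ℤ) ≃ (ℤ × ℤ) × (ℤ × ℤ) where
  toFun p := (p.2, -p.1 - p.2)
  invFun p := (-p.1 - p.2, p.1)
  left_inv p := Prod.ext (by dsimp; abel) rfl
  right_inv p := Prod.ext rfl (by dsimp; abel)

/-- The coefficient of `v a * v b * v c` in the `H¹` energy balance, for `a + b + c = 0`. -/
noncomputable def triadCoef (δ : ℝ) (p : (ℤ × ℤ) × (ℤ × ℤ)) : ℝ :=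
  znorm p.1 ^ 2 * alphaCoef δ (-p.1) p.2

theorem triadCoef_eq (δ : ℝ) (a b : ℤ × ℤ) :
    triadCoef δ (a, b) = 1 / 2 * perpDot a b * znorm a *
      (znorm (-a - b) ^ (-δ) * znorm b - znorm b ^ (-δ) * znorm (-a - b)) := by
  have hP : perpDot b (-a) = perpDot a b := by
    simp only [perpDot, Prod.fst_neg, Prod.snd_neg]
    congr 1
    ring
  simp only [triadCoef, alphaCoef, znorm_neg, hP]
  rcases eq_or_ne (znorm a) 0 with h | h
  · simp [h]
  · field_simp

theorem perpDot_rotate (a b : ℤ × ℤ) : perpDot b (-a - b) = perpDot a b := by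
  simp only [perpDot, Prod.fst_neg, Prod.snd_neg, Prod.fst_sub, Prod.snd_sub]
  congr 1
  ring

theorem triadCoef_cyclic_sum (δ : ℝ) (p : (ℤ × ℤ) × (ℤ × ℤ)) :
    triadCoef δ p + triadCoef δ (triadRotation p) +
      triadCoef δ (triadRotation (triadRotation p)) = 0 := by
  obtain ⟨a, b⟩ := p
  have hc : -b - (-a - b) = a := by abel
  have ha : -(-a - b) - a = b := by abel
  have hP : perpDot (-a - b) a = perpDot a b := by
    rw [← perpDot_rotate a b, ← perpDot_rotate b, hc]
  simp only [triadRotation, Equiv.coe_fn_mk, triadCoef_eq, hc, ha, hP, perpDot_rotate]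
  ring

/-- The product `v a * v b * v c` over the triad `a + b + c = 0`. -/
def triadProd (v : ℤ × ℤ → ℂ) (p : (ℤ × ℤ) × (ℤ × ℤ)) : ℂ :=
  v p.1 * v p.2 * v (-p.1 - p.2)

theorem triadProd_rotate (v : ℤ × ℤ → ℂ) (p : (ℤ × ℤ) × (ℤ × ℤ)) :
    triadProd v (triadRotation p) = triadProd v p := by
  have hc : -p.2 - (-p.1 - p.2) = p.1 := by abel
  simp only [triadProd, triadRotation, Equiv.coe_fn_mk, hc]
  ring

theorem summable_triad (δ : ℝ) (v : ℤ × ℤ → ℂ) (hv : (Function.support v).Finite) :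
    Summable fun p => (triadCoef δ p : ℂ) * triadProd v p := by
  refine summable_of_hasFiniteSupport ((hv.prod hv).subset fun p hp => ?_)
  simp only [Function.mem_support, triadProd, ne_eq, mul_eq_zero, not_or] at hp
  exact ⟨hp.2.1.1, hp.2.1.2⟩

theorem tsum_triad_eq_zero (δ : ℝ) (v : ℤ × ℤ → ℂ) (hv : (Function.support v).Finite) :
    ∑' p, (triadCoef δ p : ℂ) * triadProd v p = 0 := by
  set F := fun p => (triadCoef δ p : ℂ) * triadProd v p
  have hF : Summable F := summable_triad δ v hv
  have hF₁ : Summable fun p => F (triadRotation p) := triadRotation.summable_iff.mpr hF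
  have hF₂ : Summable fun p => F (triadRotation (triadRotation p)) :=
    triadRotation.summable_iff.mpr hF₁
  have e₁ : ∑' p, F (triadRotation p) = ∑' p, F p := triadRotation.tsum_eq F
  have e₂ : ∑' p, F (triadRotation (triadRotation p)) = ∑' p, F p :=
    (triadRotation.tsum_eq fun p => F (triadRotation p)).trans e₁
  have hsum : ∑' p, (F p + F (triadRotation p) + F (triadRotation (triadRotation p))) = 0 := by
    rw [← tsum_zero]
    refine tsum_congr fun p => ?_
    simp only [F, triadProd_rotate, ← add_mul]
    exact_mod_cast mul_eq_zero_of_left (by exact_mod_cast triadCoef_cyclic_sum δ p) _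
  rw [(hF.add hF₁).tsum_add hF₂, hF.tsum_add hF₁, e₁, e₂] at hsum
  linear_combination hsum / 3

/-- The conservation identity underlying Lemma 5.1: for a finitely supported sequence `v`
of Fourier coefficients of a real-valued trigonometric polynomial (`v(0) = 0`,
`v(−k) = conj(v(k))`),
`Re ( Σ_{k≠0} ‖k‖²·conj(v(k))·Σ_{h≠0, h≠k} α_{k,h}·v(h)·v(k−h) ) = 0`,
so that the `H¹` norm is conserved along the truncated modified SQG flows. -/
theorem H1_conservation (δ : ℝ) (hδ : 0 < δ) (hδ1 : δ ≤ 1)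
    (v : ℤ × ℤ → ℂ) (hv : (Function.support v).Finite)
    (hv0 : v 0 = 0) (hreal : ∀ k : ℤ × ℤ, v (-k) = starRingEnd ℂ (v k)) :
    (∑' k : {k : ℤ × ℤ // k ≠ 0},
      ((znorm (k : ℤ × ℤ) ^ 2 : ℝ) : ℂ) * starRingEnd ℂ (v (k : ℤ × ℤ)) *
        ∑' h : {h : ℤ × ℤ // h ≠ 0 ∧ h ≠ (k : ℤ × ℤ)},
          ((alphaCoef δ (k : ℤ × ℤ) (h : ℤ × ℤ) : ℝ) : ℂ)
            * v (h : ℤ × ℤ) * v ((k : ℤ × ℤ) - (h : ℤ × ℤ))).re = 0 := by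
  have inner (k : ℤ × ℤ) :
      ∑' h : {h : ℤ × ℤ // h ≠ 0 ∧ h ≠ k}, (alphaCoef δ k h : ℂ) * v h * v (k - h) =
        ∑' h, (alphaCoef δ k h : ℂ) * v h * v (k - h) := by
    refine tsum_subtype_eq_of_support_subset (s := {h | h ≠ 0 ∧ h ≠ k})
      (f := fun h => (alphaCoef δ k h : ℂ) * v h * v (k - h)) fun h hh => ⟨?_, ?_⟩
    all_goals
      rintro rfl
      simp [hv0] at hh
  have outer (f : ℤ × ℤ → ℂ) (hf : f 0 = 0) : ∑' k : {k : ℤ × ℤ // k ≠ 0}, f k = ∑' k, f k := by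
    refine tsum_subtype_eq_of_support_subset (s := {k | k ≠ 0}) fun k hk => ?_
    rintro rfl
    exact hk hf
  simp only [inner]
  rw [outer (fun k => ((znorm k ^ 2 : ℝ) : ℂ) * starRingEnd ℂ (v k) *
    ∑' h, (alphaCoef δ k h : ℂ) * v h * v (k - h)) (by simp [hv0]),
    ← (Equiv.neg (ℤ × ℤ)).tsum_eq]
  have h0 := tsum_triad_eq_zero δ v hv
  rw [(summable_triad δ v hv).tsum_prod] at h0
  rw [← Complex.zero_re, ← h0]
  congr 1
  refine tsum_congr fun a => ?_
  rw [← tsum_mul_left]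
  refine tsum_congr fun b => ?_
  simp only [Equiv.neg_apply, hreal, Complex.conj_conj, znorm_neg, triadCoef, triadProd]
  push_cast
  ring
end
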